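/- arXiv:2112.01726 — 9 statements merged into one kernel-verified Lean document; each statement's English description precedes it below -/
import Mathlib

section
/- Let c ≥ 1 and let P_1, …, P_c be N×N complex matrices that are Hermitian idempotents (orthogonal projections), pairwise orthogonal (P_i P_j = 0 for i ≠ j), and sum to the identity matrix. Let ω = exp(2πi/c) and U = Σ_{l=1}^c ω^l P_l. If A is an N×N complex matrix with P_k A P_k = 0 for all k = 1, …, c, then Σ_{k=1}^c U^k A (U^*)^k = 0. -/
open Matrix

/-- Powers of a linear combination of complete orthogonal idempotents are computed
coefficientwise. -/
theorem sum_smul_pow_of_orthogonal_idempotents {ι R S : Type*} [Fintype ι] [CommSemiring R]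
    [Semiring S] [Algebra R S] {P : ι → S} (hidem : ∀ k, P k * P k = P k)
    (horth : ∀ k l, k ≠ l → P k * P l = 0) (hsum : ∑ k, P k = 1) (a : ι → R) (n : ℕ) :
    (∑ l, a l • P l) ^ n = ∑ l, a l ^ n • P l := by
  induction n with
  | zero => simp [hsum]
  | succ n ih =>
    rw [pow_succ, ih, Finset.sum_mul]
    refine Finset.sum_congr rfl fun l _ => ?_
    rw [Finset.mul_sum, Finset.sum_eq_single l]
    · rw [smul_mul_smul_comm, hidem, pow_succ]
    · intro m _ hml
      rw [smul_mul_smul_comm, horth l m hml.symm, smul_zero]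
    · simp

/-- The sum of the first `c` positive powers of a nontrivial `c`-th root of unity vanishes. -/
theorem sum_pow_succ_eq_zero_of_pow_eq_one {R : Type*} [CommRing R] [IsDomain R] {c : ℕ} {z : R}
    (hz : z ^ c = 1) (hz1 : z ≠ 1) : ∑ k : Fin c, z ^ ((k : ℕ) + 1) = 0 := by
  rw [Fin.sum_univ_eq_sum_range (fun k => z ^ (k + 1))]
  simp_rw [pow_succ]
  rw [← Finset.sum_mul]
  have h := geom_sum_mul z c
  rw [hz, sub_self] at h
  rw [(mul_eq_zero.mp h).resolve_right (sub_ne_zero.mpr hz1), zero_mul]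

/-- Equation (3.7) of Lemma 3.3: if a family of mutually orthogonal projections
summing to the identity compresses `A` to zero, then twirling `A` by the powers
of `U = ∑ ω^l P_l` sums to zero. -/
theorem twirl_adjacency_eq_zero (c N : ℕ) (hc : 1 ≤ c)
    (P : Fin c → Matrix (Fin N) (Fin N) ℂ)
    (hherm : ∀ k, (P k).IsHermitian)
    (hidem : ∀ k, P k * P k = P k)
    (horth : ∀ k l, k ≠ l → P k * P l = 0)
    (hsum : ∑ k, P k = 1)
    (ω : ℂ) (hω : ω = Complex.exp (2 * Real.pi * Complex.I / c))
    (U : Matrix (Fin N) (Fin N) ℂ)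
    (hU : U = ∑ l : Fin c, ω ^ ((l : ℕ) + 1) • P l)
    (A : Matrix (Fin N) (Fin N) ℂ)
    (hA : ∀ k, P k * A * P k = 0) :
    ∑ k : Fin c, U ^ ((k : ℕ) + 1) * A * Uᴴ ^ ((k : ℕ) + 1) = 0 := by
  have hprim : IsPrimitiveRoot ω c := hω ▸ Complex.isPrimitiveRoot_exp c (by omega)
  have hω0 : ω ≠ 0 := hprim.ne_zero (by omega)
  have hstar : star ω = ω⁻¹ :=
    (Complex.inv_eq_conj (hprim.norm'_eq_one (by omega))).symm
  have hUH : Uᴴ = ∑ l : Fin c, (ω⁻¹) ^ ((l : ℕ) + 1) • P l := by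
    simp_rw [hU, conjTranspose_sum, conjTranspose_smul, (hherm _).eq, star_pow, hstar]
  have hterm (k : Fin c) : U ^ ((k : ℕ) + 1) * A * Uᴴ ^ ((k : ℕ) + 1) =
      ∑ l : Fin c, ∑ m : Fin c,
        (ω ^ ((l : ℕ) + 1) * (ω⁻¹) ^ ((m : ℕ) + 1)) ^ ((k : ℕ) + 1) • (P l * A * P m) := by
    rw [hUH, hU, sum_smul_pow_of_orthogonal_idempotents hidem horth hsum,
      sum_smul_pow_of_orthogonal_idempotents hidem horth hsum, Finset.sum_mul, Finset.sum_mul_sum]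
    simp_rw [smul_mul_assoc, mul_smul_comm, smul_smul, mul_pow]
  simp_rw [hterm]
  rw [Finset.sum_comm]
  refine Finset.sum_eq_zero fun l _ => ?_
  rw [Finset.sum_comm]
  refine Finset.sum_eq_zero fun m _ => ?_
  rw [← Finset.sum_smul]
  obtain rfl | hlm := eq_or_ne l m
  · rw [hA, smul_zero]
  rw [sum_pow_succ_eq_zero_of_pow_eq_one, zero_smul]
  · rw [mul_pow, pow_right_comm, pow_right_comm ω⁻¹, inv_pow, hprim.pow_eq_one]
    simp
  · intro h
    rw [inv_pow, mul_inv_eq_one₀ (pow_ne_zero _ hω0), pow_succ, pow_succ] at h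
    exact hlm (Fin.ext (hprim.pow_inj l.isLt m.isLt (mul_right_cancel₀ hω0 h)))
end

section
/- Let n ≥ 1 and let A be a Hermitian complex matrix indexed by the disjoint union of nonempty finite sets κ_1, …, κ_n (a block-partitioned Hermitian matrix with diagonal blocks A_{11}, …, A_{nn}, where A_{ii} is the square submatrix of A with rows and columns in κ_i). Then (n−1)·λ_min(A) + λ_max(A) ≤ Σ_{i=1}^n λ_max(A_{ii}), where λ_max(·) and λ_min(·) denote the largest and smallest eigenvalues of a Hermitian matrix. -/
open Matrix

open scoped MatrixOrder Matrix.Norms.L2Operator ComplexOrder in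
/-- The operator norm of a positive semidefinite block matrix is at most the sum of the norms of
its diagonal blocks. -/
theorem Matrix.PosSemidef.l2_opNorm_le_sum_l2_opNorm_submatrix {ι : Type*} [Fintype ι]
    [DecidableEq ι] {κ : ι → Type*} [∀ i, Fintype (κ i)] [∀ i, DecidableEq (κ i)]
    {P : Matrix (Σ i, κ i) (Σ i, κ i) ℂ} (hP : P.PosSemidef) :
    ‖P‖ ≤ ∑ i, ‖P.submatrix (Sigma.mk i) (Sigma.mk i)‖ := by
  obtain ⟨B, rfl⟩ := CStarAlgebra.nonneg_iff_eq_star_mul_self.mp hP.nonneg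
  have hB : B * Bᴴ = ∑ i, B.submatrix id (Sigma.mk i) * (B.submatrix id (Sigma.mk i))ᴴ := by
    ext j k
    simp [Matrix.sum_apply, Matrix.mul_apply, Fintype.sum_sigma]
  calc ‖star B * B‖ = ‖B * Bᴴ‖ := by
        rw [CStarRing.norm_star_mul_self, ← star_eq_conjTranspose, CStarRing.norm_self_mul_star]
    _ ≤ ∑ i, ‖B.submatrix id (Sigma.mk i) * (B.submatrix id (Sigma.mk i))ᴴ‖ :=
        hB ▸ norm_sum_le _ _
    _ = ∑ i, ‖(star B * B).submatrix (Sigma.mk i) (Sigma.mk i)‖ := by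
        refine Finset.sum_congr rfl fun i _ ↦ ?_
        have h := l2_opNorm_conjTranspose_mul_self (B.submatrix id (Sigma.mk i))ᴴ
        rw [conjTranspose_conjTranspose, l2_opNorm_conjTranspose] at h
        rw [h, ← l2_opNorm_conjTranspose_mul_self]
        rfl

open scoped MatrixOrder in
theorem Matrix.IsHermitian.le_algebraMap_iff_eigenvalues_le {m : Type*} [Fintype m]
    [DecidableEq m] {A : Matrix m m ℂ} (hA : A.IsHermitian) {c : ℝ} :
    A ≤ algebraMap ℝ _ c ↔ ∀ j, hA.eigenvalues j ≤ c := by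
  rw [le_algebraMap_iff_spectrum_le (ha := hA.isSelfAdjoint),
    hA.spectrum_real_eq_range_eigenvalues, Set.forall_mem_range]

open scoped MatrixOrder in
theorem Matrix.IsHermitian.algebraMap_le_iff_le_eigenvalues {m : Type*} [Fintype m]
    [DecidableEq m] {A : Matrix m m ℂ} (hA : A.IsHermitian) {c : ℝ} :
    algebraMap ℝ _ c ≤ A ↔ ∀ j, c ≤ hA.eigenvalues j := by
  rw [algebraMap_le_iff_le_spectrum (ha := hA.isSelfAdjoint),
    hA.spectrum_real_eq_range_eigenvalues, Set.forall_mem_range]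

open scoped MatrixOrder Matrix.Norms.L2Operator ComplexOrder in
/-- Lemma 4.2: for a block-partitioned Hermitian matrix with diagonal blocks
`A_{ii}`, one has `(n-1)·λ_min(A) + λ_max(A) ≤ ∑ᵢ λ_max(A_{ii})`. -/
theorem blockPartition_eigenvalue_bound (n : ℕ) (hn : 1 ≤ n)
    (κ : Fin n → Type) [∀ i, Fintype (κ i)] [∀ i, DecidableEq (κ i)]
    [∀ i, Nonempty (κ i)]
    (A : Matrix (Σ i, κ i) (Σ i, κ i) ℂ) (hA : A.IsHermitian) :
    (n - 1 : ℝ) * (⨅ j, hA.eigenvalues j) + (⨆ j, hA.eigenvalues j) ≤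
      ∑ i : Fin n, ⨆ j, (hA.submatrix (Sigma.mk i)).eigenvalues j := by
  have : Nonempty (Σ i, κ i) := ⟨⟨⟨0, hn⟩, Classical.arbitrary _⟩⟩
  set m := ⨅ j, hA.eigenvalues j
  set c : Fin n → ℝ := fun i ↦ ⨆ j, (hA.submatrix (Sigma.mk i)).eigenvalues j
  set P := A - algebraMap ℝ _ m with hPdef
  have hP : P.PosSemidef := Matrix.le_iff.mp <|
    hA.algebraMap_le_iff_le_eigenvalues.mpr fun j ↦ ciInf_le (Set.finite_range _).bddBelow j
  have hblock (i : Fin n) : ‖P.submatrix (Sigma.mk i) (Sigma.mk i)‖ ≤ c i - m := by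
    have hsub : P.submatrix (Sigma.mk i) (Sigma.mk i) =
        A.submatrix (Sigma.mk i) (Sigma.mk i) - algebraMap ℝ _ m := by
      ext j k
      simp [hPdef, Matrix.algebraMap_matrix_apply]
    have hle : P.submatrix (Sigma.mk i) (Sigma.mk i) ≤ algebraMap ℝ _ (c i - m) := by
      rw [hsub, map_sub]
      exact sub_le_sub_right ((hA.submatrix (Sigma.mk i)).le_algebraMap_iff_eigenvalues_le.mpr
        fun j ↦ le_ciSup (Set.finite_range _).bddAbove j) _
    have hnonneg := (hP.submatrix (Sigma.mk i)).nonneg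
    have hc : 0 ≤ c i - m := by
      have h := hnonneg.trans hle
      rw [Matrix.nonneg_iff_posSemidef] at h
      simpa [Matrix.algebraMap_matrix_apply] using h.diag_nonneg (i := Classical.arbitrary (κ i))
    exact (CStarAlgebra.norm_le_iff_le_algebraMap _ hc hnonneg).mpr hle
  have hnorm : ‖P‖ ≤ ∑ i, c i - n * m := by
    refine hP.l2_opNorm_le_sum_l2_opNorm_submatrix.trans ?_
    refine (Finset.sum_le_sum fun i _ ↦ hblock i).trans_eq ?_
    simp
  have hmax : ⨆ j, hA.eigenvalues j ≤ ‖P‖ + m := by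
    refine ciSup_le (hA.le_algebraMap_iff_eigenvalues_le.mp ?_)
    rw [map_add, ← sub_le_iff_le_add]
    exact hP.isHermitian.isSelfAdjoint.le_algebraMap_norm_self
  linarith
end

section
/- Let A be a Hermitian complex matrix indexed by the disjoint union of two nonempty finite sets κ_1, κ_2, with diagonal blocks A_{11} and A_{22}. Then λ_max(A) + λ_min(A) ≤ λ_max(A_{11}) + λ_max(A_{22}), where λ_max(·) and λ_min(·) denote the largest and smallest eigenvalues of a Hermitian matrix. -/
open Matrix

open scoped MatrixOrder ComplexOrder in
/-- The Rayleigh quotient of a Hermitian matrix is at most its largest eigenvalue. -/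
theorem Matrix.IsHermitian.re_dotProduct_mulVec_le_iSup_eigenvalues
    {n : Type*} [Fintype n] [DecidableEq n] {A : Matrix n n ℂ} (hA : A.IsHermitian)
    (x : n → ℂ) :
    (star x ⬝ᵥ A *ᵥ x).re ≤ (⨆ j, hA.eigenvalues j) * (star x ⬝ᵥ x).re := by
  have hle : A ≤ algebraMap ℝ _ (⨆ j, hA.eigenvalues j) := by
    refine le_algebraMap_of_spectrum_le (ha := hA) fun t ht => ?_
    rw [hA.spectrum_real_eq_range_eigenvalues] at ht
    obtain ⟨i, rfl⟩ := ht
    exact le_ciSup (Set.finite_range _).bddAbove i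
  have h := (Matrix.le_iff.mp hle).re_dotProduct_nonneg x
  simpa [Algebra.algebraMap_eq_smul_one, sub_mulVec, smul_mulVec, dotProduct_sub] using h

open scoped MatrixOrder ComplexOrder in
/-- The Rayleigh quotient of a Hermitian matrix is at least its smallest eigenvalue. -/
theorem Matrix.IsHermitian.iInf_eigenvalues_mul_le_re_dotProduct_mulVec
    {n : Type*} [Fintype n] [DecidableEq n] {A : Matrix n n ℂ} (hA : A.IsHermitian)
    (x : n → ℂ) :
    (⨅ j, hA.eigenvalues j) * (star x ⬝ᵥ x).re ≤ (star x ⬝ᵥ A *ᵥ x).re := by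
  have hle : algebraMap ℝ _ (⨅ j, hA.eigenvalues j) ≤ A := by
    refine algebraMap_le_of_le_spectrum (ha := hA) fun t ht => ?_
    rw [hA.spectrum_real_eq_range_eigenvalues] at ht
    obtain ⟨i, rfl⟩ := ht
    exact ciInf_le (Set.finite_range _).bddBelow i
  have h := (Matrix.le_iff.mp hle).re_dotProduct_nonneg x
  simpa [Algebra.algebraMap_eq_smul_one, sub_mulVec, smul_mulVec, dotProduct_sub] using h

/-- The largest eigenvalue of a Hermitian matrix is attained by the quadratic form at a unit
vector. -/
theorem Matrix.IsHermitian.exists_re_dotProduct_mulVec_eq_iSup_eigenvalues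
    {n : Type*} [Fintype n] [DecidableEq n] [Nonempty n] {A : Matrix n n ℂ}
    (hA : A.IsHermitian) :
    ∃ x : n → ℂ, (star x ⬝ᵥ x).re = 1 ∧
      (star x ⬝ᵥ A *ᵥ x).re = ⨆ j, hA.eigenvalues j := by
  obtain ⟨i, hi⟩ := exists_eq_ciSup_of_finite (f := hA.eigenvalues)
  have hone : star (hA.eigenvectorBasis i).ofLp ⬝ᵥ (hA.eigenvectorBasis i).ofLp = 1 := by
    have h := hA.eigenvectorBasis.inner_eq_one i
    rwa [EuclideanSpace.inner_eq_star_dotProduct, dotProduct_comm] at h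
  exact ⟨hA.eigenvectorBasis i, by simp [hone], by simp [hA.mulVec_eigenvectorBasis, hone, hi]⟩

/-- Scaling the two components of a vector by real numbers turns the quadratic form of a block
matrix into a binary quadratic form. -/
theorem Matrix.re_dotProduct_mulVec_sumElim_smul
    {κ₁ κ₂ : Type*} [Fintype κ₁] [Fintype κ₂] (A : Matrix (κ₁ ⊕ κ₂) (κ₁ ⊕ κ₂) ℂ)
    (u : κ₁ → ℂ) (v : κ₂ → ℂ) (s t : ℝ) :
    (star (Sum.elim (s • u) (t • v)) ⬝ᵥ A *ᵥ Sum.elim (s • u) (t • v)).re =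
      s ^ 2 * (star u ⬝ᵥ A.submatrix Sum.inl Sum.inl *ᵥ u).re +
        t ^ 2 * (star v ⬝ᵥ A.submatrix Sum.inr Sum.inr *ᵥ v).re +
        s * t * ((star u ⬝ᵥ A.toBlocks₁₂ *ᵥ v).re + (star v ⬝ᵥ A.toBlocks₂₁ *ᵥ u).re) := by
  have hstar : star (Sum.elim (s • u) (t • v)) = Sum.elim (s • star u) (t • star v) := by
    ext i; cases i <;> simp
  have h₁ : A.submatrix Sum.inl Sum.inl = A.toBlocks₁₁ := rfl
  have h₂ : A.submatrix Sum.inr Sum.inr = A.toBlocks₂₂ := rfl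
  rw [hstar, h₁, h₂]
  conv_lhs => rw [← fromBlocks_toBlocks A]
  rw [fromBlocks_mulVec, sumElim_dotProduct_sumElim, Sum.elim_comp_inl, Sum.elim_comp_inr]
  simp only [mulVec_smul, dotProduct_add, dotProduct_smul, smul_dotProduct, Complex.add_re,
    Complex.smul_re, smul_eq_mul]
  ring

/-- Scaling the two components of a vector by real numbers scales their contributions to the
squared norm by the squares. -/
theorem Matrix.re_dotProduct_sumElim_smul
    {κ₁ κ₂ : Type*} [Fintype κ₁] [Fintype κ₂] (u : κ₁ → ℂ) (v : κ₂ → ℂ) (s t : ℝ) :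
    (star (Sum.elim (s • u) (t • v)) ⬝ᵥ Sum.elim (s • u) (t • v)).re =
      s ^ 2 * (star u ⬝ᵥ u).re + t ^ 2 * (star v ⬝ᵥ v).re := by
  have hstar : star (Sum.elim (s • u) (t • v)) = Sum.elim (s • star u) (t • star v) := by
    ext i; cases i <;> simp
  rw [hstar, sumElim_dotProduct_sumElim]
  simp
  ring

/-- The smallest eigenvalue of a Hermitian matrix is at most the largest eigenvalue of any
nonempty principal submatrix. -/
theorem Matrix.IsHermitian.iInf_eigenvalues_le_iSup_eigenvalues_submatrix
    {m n : Type*} [Fintype m] [DecidableEq m] [Fintype n] [DecidableEq n] [Nonempty m]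
    {A : Matrix n n ℂ} (hA : A.IsHermitian) (f : m → n) :
    (⨅ j, hA.eigenvalues j) ≤ ⨆ j, (hA.submatrix f).eigenvalues j := by
  obtain ⟨i⟩ := ‹Nonempty m›
  have h₁ := hA.iInf_eigenvalues_mul_le_re_dotProduct_mulVec (Pi.single (f i) 1)
  have h₂ := (hA.submatrix f).re_dotProduct_mulVec_le_iSup_eigenvalues (Pi.single i 1)
  simp at h₁ h₂
  exact h₁.trans h₂

/-- Base case `n = 2` of Lemma 4.2: for a Hermitian matrix block-partitioned
into two blocks, `λ_max(A) + λ_min(A) ≤ λ_max(A₁₁) + λ_max(A₂₂)`. -/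
theorem twoBlock_eigenvalue_bound
    (κ₁ κ₂ : Type) [Fintype κ₁] [Fintype κ₂] [DecidableEq κ₁] [DecidableEq κ₂]
    [Nonempty κ₁] [Nonempty κ₂]
    (A : Matrix (κ₁ ⊕ κ₂) (κ₁ ⊕ κ₂) ℂ) (hA : A.IsHermitian) :
    (⨆ j, hA.eigenvalues j) + (⨅ j, hA.eigenvalues j) ≤
      (⨆ j, (hA.submatrix Sum.inl).eigenvalues j) +
        (⨆ j, (hA.submatrix Sum.inr).eigenvalues j) := by
  have nonneg_and_eq_zero {κ : Type} [Fintype κ] (u : κ → ℂ) :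
      0 ≤ (star u ⬝ᵥ u).re ∧ ((star u ⬝ᵥ u).re = 0 → u = 0) := by
    open scoped ComplexOrder in
    have h := Complex.nonneg_iff.mp (dotProduct_star_self_nonneg u)
    exact ⟨h.1, fun h0 => dotProduct_star_self_eq_zero.mp (Complex.ext h0 h.2.symm)⟩
  obtain ⟨x, hx, hAx⟩ := hA.exists_re_dotProduct_mulVec_eq_iSup_eigenvalues
  obtain ⟨u, v, rfl⟩ : ∃ u v, x = Sum.elim ((1 : ℝ) • u) ((1 : ℝ) • v) :=
    ⟨x ∘ Sum.inl, x ∘ Sum.inr, by simp⟩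
  rw [re_dotProduct_sumElim_smul] at hx
  rw [re_dotProduct_mulVec_sumElim_smul] at hAx
  have hu := (hA.submatrix Sum.inl).re_dotProduct_mulVec_le_iSup_eigenvalues u
  have hv := (hA.submatrix Sum.inr).re_dotProduct_mulVec_le_iSup_eigenvalues v
  obtain ⟨hu_nonneg, hu_zero⟩ := nonneg_and_eq_zero u
  obtain ⟨hv_nonneg, hv_zero⟩ := nonneg_and_eq_zero v
  rcases hu_nonneg.eq_or_lt' with h0 | hu_pos
  · obtain rfl := hu_zero h0
    have hm := hA.iInf_eigenvalues_le_iSup_eigenvalues_submatrix (Sum.inl : κ₁ → κ₁ ⊕ κ₂)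
    simp at hx hAx
    rw [hx, mul_one] at hv
    linarith
  rcases hv_nonneg.eq_or_lt' with h0 | hv_pos
  · obtain rfl := hv_zero h0
    have hm := hA.iInf_eigenvalues_le_iSup_eigenvalues_submatrix (Sum.inr : κ₂ → κ₁ ⊕ κ₂)
    simp at hx hAx
    rw [hx, mul_one] at hu
    linarith
  -- Swapping the weights of the two components gives a test vector orthogonal to the maximizer.
  have hw := hA.iInf_eigenvalues_mul_le_re_dotProduct_mulVec
    (Sum.elim ((star v ⬝ᵥ v).re • u) ((-(star u ⬝ᵥ u).re) • v))
  rw [re_dotProduct_sumElim_smul, re_dotProduct_mulVec_sumElim_smul] at hw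
  generalize (star u ⬝ᵥ u).re = α at *
  generalize (star v ⬝ᵥ v).re = β at *
  generalize (⨆ j, hA.eigenvalues j) = M at *
  generalize (⨅ j, hA.eigenvalues j) = m at *
  generalize (⨆ j, (hA.submatrix Sum.inl).eigenvalues j) = a at *
  generalize (⨆ j, (hA.submatrix Sum.inr).eigenvalues j) = b at *
  generalize (star u ⬝ᵥ A.submatrix Sum.inl Sum.inl *ᵥ u).re = p at *
  generalize (star v ⬝ᵥ A.submatrix Sum.inr Sum.inr *ᵥ v).re = q at *
  generalize (star u ⬝ᵥ A.toBlocks₁₂ *ᵥ v).re + (star v ⬝ᵥ A.toBlocks₂₁ *ᵥ u).re = r at *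
  have hβ : β = 1 - α := by linarith
  have hm : m ≤ a * β + b * α - r := by
    refine le_of_mul_le_mul_left ?_ (mul_pos hu_pos hv_pos)
    have h₁ := mul_le_mul_of_nonneg_left hu (sq_nonneg β)
    have h₂ := mul_le_mul_of_nonneg_left hv (sq_nonneg α)
    have h₃ : α * β * m = m * (β ^ 2 * α + (-α) ^ 2 * β) := by rw [hβ]; ring
    linarith
  rw [hβ] at hm hv
  linarith
end

section
/- Let c ≥ 1 and let P_1, …, P_c be N×N complex matrices that are Hermitian idempotents (orthogonal projections), pairwise orthogonal (P_i P_j = 0 for i ≠ j), and sum to the identity matrix, with N ≥ 1. If A is an N×N Hermitian complex matrix with P_k A P_k = 0 for all k = 1, …, c, then (c−1)·λ_min(A) + λ_max(A) ≤ 0, where λ_max(A) and λ_min(A) denote the largest and smallest eigenvalues of A. -/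
open Matrix

/-- Pinching inequality: a nonnegative element is at most the number of blocks times its pinching
along a self-adjoint resolution of the identity. The inequality is doubled to avoid division. -/
theorem two_nsmul_le_card_nsmul_sum_conjugate {R ι : Type*} [Ring R] [StarRing R] [PartialOrder R]
    [StarOrderedRing R] [Fintype ι] (P : ι → R) (hP : ∀ k, IsSelfAdjoint (P k))
    (hsum : ∑ k, P k = 1) {B : R} (hB : 0 ≤ B) :
    2 • B ≤ 2 • (Fintype.card ι • ∑ k, P k * B * P k) := by
  have hnonneg : 0 ≤ ∑ k, ∑ l, (P k - P l) * B * (P k - P l) :=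
    Finset.sum_nonneg fun k _ => Finset.sum_nonneg fun l _ =>
      ((hP k).sub (hP l)).conjugate_nonneg hB
  have hcross : ∑ k, ∑ l, P k * B * P l = B := by
    simp_rw [← Finset.mul_sum, hsum, mul_one, ← Finset.sum_mul, hsum, one_mul]
  have hcross' : ∑ k, ∑ l, P l * B * P k = B := by
    rw [Finset.sum_comm, hcross]
  have hexpand : ∑ k, ∑ l, (P k - P l) * B * (P k - P l) =
      2 • (Fintype.card ι • ∑ k, P k * B * P k) - 2 • B := by
    simp only [sub_mul, mul_sub, Finset.sum_sub_distrib, hcross, hcross', Finset.sum_const,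
      Finset.card_univ, ← Finset.smul_sum, two_nsmul]
    abel
  exact sub_nonneg.mp (hexpand ▸ hnonneg)

open scoped MatrixOrder in
/-- Core inequality of Theorem 4.3 (quantum Hoffman bound): if a Hermitian
matrix `A` is compressed to zero by a `c`-quantum coloring, then
`(c-1)·λ_min(A) + λ_max(A) ≤ 0`. -/
theorem hoffman_core (c N : ℕ) (hc : 1 ≤ c) (hN : 1 ≤ N)
    (P : Fin c → Matrix (Fin N) (Fin N) ℂ)
    (hherm : ∀ k, (P k).IsHermitian)
    (hidem : ∀ k, P k * P k = P k)
    (horth : ∀ k l, k ≠ l → P k * P l = 0)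
    (hsum : ∑ k, P k = 1)
    (A : Matrix (Fin N) (Fin N) ℂ) (hA : A.IsHermitian)
    (hcolor : ∀ k, P k * A * P k = 0) :
    (c - 1 : ℝ) * (⨅ i, hA.eigenvalues i) + (⨆ i, hA.eigenvalues i) ≤ 0 := by
  have : NeZero N := ⟨by omega⟩
  set m := ⨅ i, hA.eigenvalues i
  have hB : 0 ≤ A - algebraMap ℝ _ m := by
    rw [sub_nonneg, algebraMap_le_iff_le_spectrum (ha := hA.isSelfAdjoint),
      hA.spectrum_real_eq_range_eigenvalues]
    rintro _ ⟨i, rfl⟩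
    exact ciInf_le (Set.finite_range _).bddBelow i
  have hpinch : ∑ k, P k * (A - algebraMap ℝ _ m) * P k = -algebraMap ℝ _ m := by
    simp [mul_sub, sub_mul, hcolor, Algebra.algebraMap_eq_smul_one, hidem, ← Finset.smul_sum, hsum]
  have hle := two_nsmul_le_card_nsmul_sum_conjugate P (fun k => (hherm k).isSelfAdjoint) hsum hB
  have hbound : A ≤ algebraMap ℝ _ (-((c - 1 : ℝ) * m)) := by
    rw [hpinch, ← sub_nonneg] at hle
    have hhalf := smul_nonneg (by norm_num : (0 : ℝ) ≤ 1 / 2) hle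
    rw [← sub_nonneg]
    convert hhalf using 1
    simp only [Algebra.algebraMap_eq_smul_one, Fintype.card_fin]
    module
  rw [le_algebraMap_iff_spectrum_le (ha := hA.isSelfAdjoint),
    hA.spectrum_real_eq_range_eigenvalues] at hbound
  have hsup : ⨆ i, hA.eigenvalues i ≤ -((c - 1 : ℝ) * m) :=
    ciSup_le fun i => hbound _ ⟨i, rfl⟩
  linarith
end

section
/- Let c ≥ 1 and let P_1, …, P_c be N×N complex matrices that are Hermitian idempotents (orthogonal projections), pairwise orthogonal (P_i P_j = 0 for i ≠ j), and sum to the identity matrix, with N ≥ 1. Let A be a nonzero N×N Hermitian complex matrix with P_k A P_k = 0 for all k = 1, …, c. Then λ_min(A) < 0 and 1 + λ_max(A)/|λ_min(A)| ≤ c, where λ_max(A) and λ_min(A) denote the largest and smallest eigenvalues of A. -/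
open Matrix

open scoped ComplexOrder MatrixOrder in
/-- The pinching inequality: `B ≤ c • ∑ k, P k * B * P k` for positive semidefinite `B` and `c`
Hermitian matrices `P k` summing to the identity. -/
theorem Matrix.PosSemidef.le_card_smul_sum_mul_mul {ι n : Type*} [Fintype ι] [Fintype n]
    [DecidableEq n] {B : Matrix n n ℂ} (hB : B.PosSemidef) {P : ι → Matrix n n ℂ}
    (hherm : ∀ k, (P k).IsHermitian) (hsum : ∑ k, P k = 1) :
    B ≤ (Fintype.card ι : ℝ) • ∑ k, P k * B * P k := by
  have hsq : (∑ k, ∑ l, (P k - P l) * B * (P k - P l)).PosSemidef := by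
    refine posSemidef_sum _ fun k _ => posSemidef_sum _ fun l _ => ?_
    have h := hB.conjTranspose_mul_mul_same (P k - P l)
    rwa [((hherm k).sub (hherm l)).eq] at h
  have hcross : ∑ k, ∑ l, P k * B * P l = B := by
    simp_rw [← Finset.mul_sum, hsum, mul_one, ← Finset.sum_mul, hsum, one_mul]
  have hcross' : ∑ k, ∑ l, P l * B * P k = B := by rw [Finset.sum_comm, hcross]
  have hexpand : ∑ k, ∑ l, (P k - P l) * B * (P k - P l) =
      (2 : ℝ) • ((Fintype.card ι : ℝ) • (∑ k, P k * B * P k) - B) := by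
    simp only [sub_mul, mul_sub, Finset.sum_sub_distrib, hcross, hcross', Finset.sum_const,
      Finset.card_univ, ← Finset.smul_sum, Nat.cast_smul_eq_nsmul]
    rw [two_smul]
    abel
  rw [hexpand] at hsq
  rw [Matrix.le_iff]
  simpa [smul_smul] using hsq.smul (show (0 : ℝ) ≤ 1 / 2 by norm_num)

open scoped ComplexOrder MatrixOrder in
/-- If every `P k` compresses `A` to zero, a lower bound `m` on the spectrum of `A` yields the upper
bound `(1 - c) * m`. -/
theorem Matrix.IsHermitian.eigenvalues_le_of_compression_eq_zero {ι n : Type*} [Fintype ι]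
    [Fintype n] [DecidableEq n] {A : Matrix n n ℂ} (hA : A.IsHermitian) {P : ι → Matrix n n ℂ}
    (hherm : ∀ k, (P k).IsHermitian) (hidem : ∀ k, P k * P k = P k) (hsum : ∑ k, P k = 1)
    (hzero : ∀ k, P k * A * P k = 0) {m : ℝ} (hm : ∀ i, m ≤ hA.eigenvalues i) (i : n) :
    hA.eigenvalues i ≤ (1 - Fintype.card ι) * m := by
  have hsa : IsSelfAdjoint A := hA
  have hlow : algebraMap ℝ (Matrix n n ℂ) m ≤ A := by
    rw [algebraMap_le_iff_le_spectrum, hA.spectrum_real_eq_range_eigenvalues]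
    rintro _ ⟨j, rfl⟩
    exact hm j
  have hpinch := (Matrix.le_iff.mp hlow).le_card_smul_sum_mul_mul hherm hsum
  have hcompr : ∑ k, P k * (A - algebraMap ℝ (Matrix n n ℂ) m) * P k = -(m • 1) := by
    simp [Algebra.algebraMap_eq_smul_one, mul_sub, sub_mul, hzero, hidem, ← Finset.smul_sum, hsum]
  rw [hcompr, sub_le_iff_le_add] at hpinch
  have hup : A ≤ algebraMap ℝ (Matrix n n ℂ) ((1 - Fintype.card ι) * m) := by
    refine hpinch.trans_eq ?_
    rw [Algebra.algebraMap_eq_smul_one, Algebra.algebraMap_eq_smul_one]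
    module
  rw [le_algebraMap_iff_spectrum_le] at hup
  exact hup _ (hA.eigenvalues_mem_spectrum_real i)

/-- Ratio form of Theorem 4.3 (quantum Hoffman bound): if a nonzero Hermitian
matrix `A` is compressed to zero by a `c`-quantum coloring, then
`λ_min(A) < 0` and `1 + λ_max(A)/|λ_min(A)| ≤ c`. -/
theorem hoffman_bound (c N : ℕ) (hc : 1 ≤ c) (hN : 1 ≤ N)
    (P : Fin c → Matrix (Fin N) (Fin N) ℂ)
    (hherm : ∀ k, (P k).IsHermitian)
    (hidem : ∀ k, P k * P k = P k)
    (horth : ∀ k l, k ≠ l → P k * P l = 0)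
    (hsum : ∑ k, P k = 1)
    (A : Matrix (Fin N) (Fin N) ℂ) (hA : A.IsHermitian) (hA0 : A ≠ 0)
    (hcolor : ∀ k, P k * A * P k = 0) :
    (⨅ i, hA.eigenvalues i) < 0 ∧
      1 + (⨆ i, hA.eigenvalues i) / |⨅ i, hA.eigenvalues i| ≤ (c : ℝ) := by
  have : Nonempty (Fin N) := ⟨⟨0, hN⟩⟩
  have hmin (i : Fin N) : (⨅ i, hA.eigenvalues i) ≤ hA.eigenvalues i :=
    ciInf_le (Set.finite_range _).bddBelow i
  have hle (i : Fin N) : hA.eigenvalues i ≤ (1 - c) * ⨅ i, hA.eigenvalues i := by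
    simpa using hA.eigenvalues_le_of_compression_eq_zero hherm hidem hsum hcolor hmin i
  have hc' : (1 : ℝ) ≤ c := by exact_mod_cast hc
  have hneg : (⨅ i, hA.eigenvalues i) < 0 := by
    by_contra! hnonneg
    refine hA0 (hA.eigenvalues_eq_zero_iff.mp (funext fun i => le_antisymm ?_ ?_))
    · exact (hle i).trans (mul_nonpos_of_nonpos_of_nonneg (by linarith) hnonneg)
    · exact hnonneg.trans (hmin i)
  refine ⟨hneg, ?_⟩
  have hdiv : (⨆ i, hA.eigenvalues i) / |⨅ i, hA.eigenvalues i| ≤ c - 1 := by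
    rw [abs_of_neg hneg, div_le_iff₀ (neg_pos.mpr hneg)]
    linarith [ciSup_le hle]
  linarith
end

section
/- Let r ≥ 1 and let X and Y be positive semidefinite complex matrices indexed by the disjoint union of finite sets κ_1, …, κ_r (conformally block-partitioned with diagonal blocks X_{ii}, Y_{ii}). If X_{ii} = Y_{ii} for all i = 1, …, r and X Y = 0, then Tr(X^* X) ≤ (r−1) · Tr(Y^* Y). -/
open Matrix
open scoped ComplexOrder

/-- The trace of `Aᴴ * A` is the sum of the squared norms of the entries of `A`. -/
theorem trace_conjTranspose_mul_self_eq_sum_norm_sq {m n : Type*} [Fintype m] [Fintype n]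
    (A : Matrix m n ℂ) :
    (Aᴴ * A).trace = ((∑ p, ∑ q, ‖A p q‖ ^ 2 : ℝ) : ℂ) := by
  simp only [Matrix.trace, Matrix.diag_apply, Matrix.mul_apply, Matrix.conjTranspose_apply]
  rw [Finset.sum_comm]
  push_cast
  refine Finset.sum_congr rfl fun p _ => Finset.sum_congr rfl fun q _ => ?_
  exact Complex.conj_mul' _

/-- `Bᴴ * B` and `B * Bᴴ` have the same Frobenius norm. -/
theorem sum_norm_sq_conjTranspose_mul_self {m n : Type*} [Fintype m] [Fintype n]
    (B : Matrix m n ℂ) :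
    ∑ p, ∑ q, ‖(Bᴴ * B) p q‖ ^ 2 = ∑ p, ∑ q, ‖(B * Bᴴ) p q‖ ^ 2 := by
  have h : ((Bᴴ * B)ᴴ * (Bᴴ * B)).trace = ((B * Bᴴ)ᴴ * (B * Bᴴ)).trace := by
    simp only [Matrix.conjTranspose_mul, Matrix.conjTranspose_conjTranspose]
    rw [Matrix.mul_assoc, Matrix.trace_mul_comm]
    simp only [Matrix.mul_assoc]
  rw [trace_conjTranspose_mul_self_eq_sum_norm_sq,
    trace_conjTranspose_mul_self_eq_sum_norm_sq] at h
  exact_mod_cast h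

/-- The squared Frobenius norm of a positive semidefinite matrix with `ι × ι` blocks is at most
`card ι` times the sum of the squared Frobenius norms of its diagonal blocks. -/
theorem Matrix.PosSemidef.sum_norm_sq_le_card_mul_sum_blocks {ι : Type*} [Fintype ι]
    {κ : ι → Type*} [∀ i, Fintype (κ i)]
    {X : Matrix (Σ i, κ i) (Σ i, κ i) ℂ} (hX : X.PosSemidef) :
    ∑ p, ∑ q, ‖X p q‖ ^ 2 ≤
      (Fintype.card ι : ℝ) * ∑ i, ∑ a : κ i, ∑ b : κ i, ‖X ⟨i, a⟩ ⟨i, b⟩‖ ^ 2 := by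
  classical
  obtain ⟨B, rfl⟩ : ∃ B : Matrix (Σ i, κ i) (Σ i, κ i) ℂ, X = Bᴴ * B := by
    open scoped MatrixOrder in
    exact CStarAlgebra.nonneg_iff_eq_star_mul_self.mp hX.nonneg
  let C (i : ι) : Matrix (Σ i, κ i) (κ i) ℂ := B.submatrix id (Sigma.mk i)
  have hsum (s t) : (B * Bᴴ) s t = ∑ i, (C i * (C i)ᴴ) s t := by
    simp [C, Matrix.mul_apply, Fintype.sum_sigma]
  have hblock (i : ι) : ∑ a : κ i, ∑ b : κ i, ‖(Bᴴ * B) ⟨i, a⟩ ⟨i, b⟩‖ ^ 2 =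
      ∑ s, ∑ t, ‖(C i * (C i)ᴴ) s t‖ ^ 2 := by
    rw [← sum_norm_sq_conjTranspose_mul_self]
    simp [C, Matrix.mul_apply]
  rw [sum_norm_sq_conjTranspose_mul_self]
  simp only [hblock]
  calc ∑ s, ∑ t, ‖(B * Bᴴ) s t‖ ^ 2
      ≤ ∑ s, ∑ t, (Fintype.card ι : ℝ) * ∑ i, ‖(C i * (C i)ᴴ) s t‖ ^ 2 := by
        refine Finset.sum_le_sum fun s _ => Finset.sum_le_sum fun t _ => ?_
        rw [hsum]
        exact (pow_le_pow_left₀ (norm_nonneg _) (norm_sum_le _ _) 2).trans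
          sq_sum_le_card_mul_sum_sq
    _ = (Fintype.card ι : ℝ) * ∑ i, ∑ s, ∑ t, ‖(C i * (C i)ᴴ) s t‖ ^ 2 := by
        simp only [← Finset.mul_sum]
        rw [Finset.sum_comm (s := (Finset.univ : Finset ι))]
        congr! 2 with s
        exact Finset.sum_comm

/-- Entries in diagonal blocks, summed over all pairs of indices or block by block. -/
theorem sum_filter_fst_eq_sum_blocks {ι : Type*} [Fintype ι] [DecidableEq ι]
    {κ : ι → Type*} [∀ i, Fintype (κ i)] (f : (Σ i, κ i) → (Σ i, κ i) → ℝ) :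
    ∑ z : (Σ i, κ i) × (Σ i, κ i) with z.1.1 = z.2.1, f z.1 z.2 =
      ∑ i, ∑ a : κ i, ∑ b : κ i, f ⟨i, a⟩ ⟨i, b⟩ := by
  rw [Finset.sum_filter, Fintype.sum_prod_type, Fintype.sum_sigma]
  refine Finset.sum_congr rfl fun i _ => Finset.sum_congr rfl fun a _ => ?_
  rw [Fintype.sum_sigma, Finset.sum_eq_single i]
  · simp
  · intro j _ hj
    simp [hj.symm]
  · simp

/-- If `X * Y = 0` with `Y` Hermitian and `X`, `Y` agree on a set of entries, then the
Cauchy–Schwarz inequality on the remaining entries bounds the common part. -/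
theorem sq_sum_filter_le_of_mul_eq_zero {n : Type*} [Fintype n] {X Y : Matrix n n ℂ}
    (hY : Y.IsHermitian) (hXY : X * Y = 0) (P : n × n → Prop) [DecidablePred P]
    (h : ∀ z, P z → X z.1 z.2 = Y z.1 z.2) :
    (∑ z with P z, ‖X z.1 z.2‖ ^ 2) ^ 2 ≤
      (∑ z with ¬ P z, ‖X z.1 z.2‖ ^ 2) * ∑ z with ¬ P z, ‖Y z.1 z.2‖ ^ 2 := by
  have htr : ∑ z : n × n, X z.1 z.2 * star (Y z.1 z.2) = 0 := by
    have h0 : (X * Y).trace = 0 := by simp [hXY]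
    rw [← h0, Fintype.sum_prod_type]
    simp only [Matrix.trace, Matrix.diag_apply, Matrix.mul_apply, hY.apply]
  rw [← Finset.sum_filter_add_sum_filter_not _ P] at htr
  have hdiag : ∑ z with P z, X z.1 z.2 * star (Y z.1 z.2) =
      ((∑ z with P z, ‖X z.1 z.2‖ ^ 2 : ℝ) : ℂ) := by
    push_cast
    refine Finset.sum_congr rfl fun z hz => ?_
    rw [← h z (Finset.mem_filter.mp hz).2]
    exact Complex.mul_conj' _
  rw [hdiag] at htr
  have hle : ∑ z with P z, ‖X z.1 z.2‖ ^ 2 ≤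
      ∑ z with ¬ P z, ‖X z.1 z.2‖ * ‖Y z.1 z.2‖ := by
    calc ∑ z with P z, ‖X z.1 z.2‖ ^ 2
        = ‖((∑ z with P z, ‖X z.1 z.2‖ ^ 2 : ℝ) : ℂ)‖ := by
          rw [Complex.norm_real, Real.norm_of_nonneg (by positivity)]
      _ = ‖∑ z with ¬ P z, X z.1 z.2 * star (Y z.1 z.2)‖ := by
          rw [eq_neg_of_add_eq_zero_left htr, norm_neg]
      _ ≤ _ := by
          refine (norm_sum_le _ _).trans_eq ?_
          simp
  exact (pow_le_pow_left₀ (by positivity) hle 2).trans (Finset.sum_mul_sq_le_sq_mul_sq _ _ _)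

/-- Lemma 4.8 (Ando–Lin): if `X, Y` are conformally block-partitioned positive
semidefinite matrices with equal diagonal blocks and `XY = 0`, then
`Tr(X^*X) ≤ (r-1)·Tr(Y^*Y)`. -/
theorem ando_lin (r : ℕ) (hr : 1 ≤ r)
    (κ : Fin r → Type) [∀ i, Fintype (κ i)] [∀ i, DecidableEq (κ i)]
    (X Y : Matrix (Σ i, κ i) (Σ i, κ i) ℂ)
    (hX : X.PosSemidef) (hY : Y.PosSemidef)
    (hdiag : ∀ i, X.submatrix (Sigma.mk i) (Sigma.mk i) =
      Y.submatrix (Sigma.mk i) (Sigma.mk i))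
    (hXY : X * Y = 0) :
    (Xᴴ * X).trace ≤ ((r : ℂ) - 1) * (Yᴴ * Y).trace := by
  let P (z : (Σ i, κ i) × (Σ i, κ i)) : Prop := z.1.1 = z.2.1
  have hP (z) (hz : P z) : X z.1 z.2 = Y z.1 z.2 := by
    obtain ⟨⟨i, a⟩, ⟨j, b⟩⟩ := z
    obtain rfl : i = j := hz
    exact congr_fun₂ (hdiag i) a b
  have hcs := sq_sum_filter_le_of_mul_eq_zero hY.isHermitian hXY P hP
  have hblocks := hX.sum_norm_sq_le_card_mul_sum_blocks
  rw [← sum_filter_fst_eq_sum_blocks (fun p q => ‖X p q‖ ^ 2), Fintype.card_fin] at hblocks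
  have hdiagY : ∑ z with P z, ‖Y z.1 z.2‖ ^ 2 = ∑ z with P z, ‖X z.1 z.2‖ ^ 2 :=
    Finset.sum_congr rfl fun z hz => by rw [hP z (Finset.mem_filter.mp hz).2]
  have hsplit (A : Matrix (Σ i, κ i) (Σ i, κ i) ℂ) : ∑ p, ∑ q, ‖A p q‖ ^ 2 =
      ∑ z with P z, ‖A z.1 z.2‖ ^ 2 + ∑ z with ¬ P z, ‖A z.1 z.2‖ ^ 2 := by
    rw [Finset.sum_filter_add_sum_filter_not, Fintype.sum_prod_type]
  rw [trace_conjTranspose_mul_self_eq_sum_norm_sq, trace_conjTranspose_mul_self_eq_sum_norm_sq]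
  suffices ∑ p, ∑ q, ‖X p q‖ ^ 2 ≤ ((r : ℝ) - 1) * ∑ p, ∑ q, ‖Y p q‖ ^ 2 by exact_mod_cast this
  rw [hsplit] at hblocks
  rw [hsplit, hsplit, hdiagY]
  have hr' : (1 : ℝ) ≤ r := by exact_mod_cast hr
  have ha : 0 ≤ ∑ z with P z, ‖X z.1 z.2‖ ^ 2 := by positivity
  have hx : 0 ≤ ∑ z with ¬ P z, ‖X z.1 z.2‖ ^ 2 := by positivity
  have hy : 0 ≤ ∑ z with ¬ P z, ‖Y z.1 z.2‖ ^ 2 := by positivity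
  change _ ≤ (r : ℝ) * ∑ z with P z, ‖X z.1 z.2‖ ^ 2 at hblocks
  generalize ∑ z with P z, ‖X z.1 z.2‖ ^ 2 = a at *
  generalize ∑ z with ¬ P z, ‖X z.1 z.2‖ ^ 2 = x at *
  generalize ∑ z with ¬ P z, ‖Y z.1 z.2‖ ^ 2 = y at *
  rcases hx.eq_or_lt with rfl | hx
  · obtain rfl : a = 0 := by nlinarith
    nlinarith
  · refine le_of_mul_le_mul_left ?_ hx
    have h₁ := mul_le_mul_of_nonneg_left hcs (sub_nonneg.mpr hr')
    have h₂ := mul_nonneg (sub_nonneg.mpr hblocks) (add_nonneg ha hx.le)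
    linarith
end

section
/- Let c ≥ 1 and let P_1, …, P_c be N×N complex matrices that are Hermitian idempotents (orthogonal projections), pairwise orthogonal (P_i P_j = 0 for i ≠ j), and sum to the identity matrix. Let A be an N×N Hermitian complex matrix with P_k A P_k = 0 for all k = 1, …, c, with eigenvalues λ_1, …, λ_N (with multiplicity). Set s⁺ = Σ_{λ_i > 0} λ_i² and s⁻ = Σ_{λ_i < 0} λ_i². Then s⁺ ≤ (c−1)·s⁻ and s⁻ ≤ (c−1)·s⁺. -/
open Matrix
open scoped ComplexOrder MatrixOrder

section

variable {n ι : Type*} [Fintype n] [Fintype ι]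

/-- The trace of the square of a Hermitian matrix is nonnegative. -/
theorem Matrix.IsHermitian.re_trace_mul_self_nonneg {M : Matrix n n ℂ} (hM : M.IsHermitian) :
    0 ≤ (M * M).trace.re := by
  have h := (posSemidef_conjTranspose_mul_self M).trace_nonneg
  rw [hM.eq] at h
  exact (Complex.le_def.1 h).1

/-- The Cauchy–Schwarz inequality for the trace form on Hermitian matrices. -/
theorem Matrix.IsHermitian.re_trace_mul_sq_le {M K : Matrix n n ℂ}
    (hM : M.IsHermitian) (hK : K.IsHermitian) :
    (M * K).trace.re ^ 2 ≤ (M * M).trace.re * (K * K).trace.re := by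
  have key : ∀ t : ℝ, 0 ≤ (M * M).trace.re * (t * t) + (2 * (M * K).trace.re) * t
      + (K * K).trace.re := by
    intro t
    have hH : (t • M + K).IsHermitian := by
      refine IsHermitian.add ?_ hK
      rw [IsHermitian, conjTranspose_smul, hM.eq, star_trivial]
    have h := hH.re_trace_mul_self_nonneg
    simp only [add_mul, mul_add, trace_add, smul_mul_assoc, mul_smul_comm, trace_smul,
      Complex.add_re, Complex.real_smul, Complex.re_ofReal_mul, trace_mul_comm K M] at h
    linarith
  have := discrim_le_zero key
  rw [discrim] at this
  linarith

/-- A positive semidefinite matrix is dominated, in the trace form, by the number of blocks times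
its pinching. -/
theorem Matrix.PosSemidef.re_trace_mul_self_le_card_mul_sum [DecidableEq n] {X : Matrix n n ℂ}
    (hX : X.PosSemidef) {P : ι → Matrix n n ℂ} (hP : ∀ k, (P k).IsHermitian)
    (hsum : ∑ k, P k = 1) :
    (X * X).trace.re ≤ Fintype.card ι * ∑ k, (P k * X * P k * X).trace.re := by
  obtain ⟨B, rfl⟩ : ∃ B : Matrix n n ℂ, X = Bᴴ * B :=
    CStarAlgebra.nonneg_iff_eq_star_mul_self.1 hX.nonneg
  have hZ : ∀ k, (B * P k * Bᴴ).IsHermitian := fun k => isHermitian_mul_mul_conjTranspose B (hP k)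
  have htr : ∀ k l, (P k * (Bᴴ * B) * P l * (Bᴴ * B)).trace
      = (B * P k * Bᴴ * (B * P l * Bᴴ)).trace := by
    intro k l
    rw [← mul_assoc (P k * (Bᴴ * B) * P l), trace_mul_comm]
    simp only [mul_assoc]
  have hle : ∀ k l, (B * P k * Bᴴ * (B * P l * Bᴴ)).trace.re
      ≤ ((B * P k * Bᴴ * (B * P k * Bᴴ)).trace.re
        + (B * P l * Bᴴ * (B * P l * Bᴴ)).trace.re) / 2 := by
    intro k l
    have h := ((hZ k).sub (hZ l)).re_trace_mul_self_nonneg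
    rw [sub_mul, mul_sub, mul_sub] at h
    simp only [trace_sub, Complex.sub_re] at h
    rw [trace_mul_comm (B * P l * Bᴴ) (B * P k * Bᴴ)] at h
    linarith
  have hexp : (Bᴴ * B * (Bᴴ * B)).trace.re
      = ∑ k, ∑ l, (B * P k * Bᴴ * (B * P l * Bᴴ)).trace.re := by
    have h : Bᴴ * B * (Bᴴ * B) = (∑ k, P k) * (Bᴴ * B) * (∑ l, P l) * (Bᴴ * B) := by
      rw [hsum, one_mul, mul_one]
    rw [h]
    simp only [Finset.sum_mul, Finset.mul_sum, trace_sum, Complex.re_sum, htr]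
    rw [Finset.sum_comm]
  rw [hexp]
  simp only [htr]
  refine (Finset.sum_le_sum fun k _ => Finset.sum_le_sum fun l _ => hle k l).trans_eq ?_
  simp only [← Finset.sum_div, Finset.sum_add_distrib, Finset.sum_const, Finset.card_univ,
    nsmul_eq_mul, ← Finset.mul_sum]
  ring

/-- Two positive semidefinite matrices with zero product and the same diagonal blocks have
comparable Frobenius norms. -/
theorem Matrix.PosSemidef.re_trace_mul_self_le_of_mul_eq_zero [DecidableEq n]
    {X Y : Matrix n n ℂ} (hX : X.PosSemidef) (hY : Y.PosSemidef) (hXY : X * Y = 0)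
    {P : ι → Matrix n n ℂ} (hP : ∀ k, (P k).IsHermitian) (hidem : ∀ k, P k * P k = P k)
    (horth : ∀ k l, k ≠ l → P k * P l = 0) (hsum : ∑ k, P k = 1)
    (hdiag : ∀ k, P k * X * P k = P k * Y * P k) (hι : 1 ≤ Fintype.card ι) :
    (X * X).trace.re ≤ (Fintype.card ι - 1 : ℝ) * (Y * Y).trace.re := by
  set D := ∑ k, P k * X * P k with hD
  have hDH : D.IsHermitian := by
    rw [IsHermitian, hD, conjTranspose_sum]
    refine Finset.sum_congr rfl fun k _ => ?_
    simp only [conjTranspose_mul, (hP k).eq, hX.isHermitian.eq, mul_assoc]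
  have hDP : ∀ k, P k * D * P k = P k * X * P k := by
    intro k
    rw [hD, Finset.mul_sum, Finset.sum_mul, Finset.sum_eq_single k]
    · rw [← mul_assoc, ← mul_assoc, hidem, mul_assoc, hidem]
    · intro l _ hl
      rw [← mul_assoc, ← mul_assoc, horth k l hl.symm]
      simp
    · simp
  have htr : ∀ M, (∀ k, P k * M * P k = P k * X * P k) → (D * M).trace = (D * D).trace := by
    have h : ∀ M, (D * M).trace = ∑ k, (X * (P k * M * P k)).trace := by
      intro M
      rw [hD, Finset.sum_mul, trace_sum]
      refine Finset.sum_congr rfl fun k _ => ?_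
      rw [mul_assoc, mul_assoc, trace_mul_comm]
      simp only [mul_assoc]
    intro M hM
    simp only [h, hM, hDP]
  have hDX := htr X fun _ => rfl
  have hDY := htr Y fun k => (hdiag k).symm
  have hpinch : (X * X).trace.re ≤ Fintype.card ι * (D * D).trace.re := by
    have h := hX.re_trace_mul_self_le_card_mul_sum hP hsum
    rwa [← Complex.re_sum, ← trace_sum, ← Finset.sum_mul, ← hD, hDX] at h
  have hcs := (hX.isHermitian.sub hDH).re_trace_mul_sq_le (hY.isHermitian.sub hDH)
  simp only [sub_mul, mul_sub, trace_sub, Complex.sub_re, hXY, trace_zero, Complex.zero_re,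
    trace_mul_comm X D, trace_mul_comm Y D, hDX, hDY] at hcs
  have hd := hDH.re_trace_mul_self_nonneg
  have hy := (hY.isHermitian.sub hDH).re_trace_mul_self_nonneg
  simp only [sub_mul, mul_sub, trace_sub, Complex.sub_re, trace_mul_comm Y D, hDY] at hy
  have hm : (1 : ℝ) ≤ Fintype.card ι := by exact_mod_cast hι
  generalize (X * X).trace.re = x at *
  generalize (Y * Y).trace.re = y at *
  generalize (D * D).trace.re = d at *
  generalize (Fintype.card ι : ℝ) = m at *
  have hdy : d ≤ (m - 1) * (y - d) := by
    rcases hd.eq_or_lt with rfl | hpos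
    · exact mul_nonneg (by linarith) (by linarith)
    · refine le_of_mul_le_mul_left ?_ hpos
      nlinarith [mul_le_mul_of_nonneg_right hpinch (by linarith : 0 ≤ y - d)]
  linarith

/-- The Hermitian matrix with the eigenvectors of `A` and the eigenvalues `f`. -/
noncomputable def Matrix.IsHermitian.spectralDiagonal [DecidableEq n] {A : Matrix n n ℂ}
    (hA : A.IsHermitian) (f : n → ℝ) : Matrix n n ℂ :=
  (hA.eigenvectorUnitary : Matrix n n ℂ) * diagonal (fun i => (f i : ℂ)) *
    (hA.eigenvectorUnitary : Matrix n n ℂ)ᴴ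

namespace Matrix.IsHermitian

variable [DecidableEq n] {A : Matrix n n ℂ} (hA : A.IsHermitian)

theorem spectralDiagonal_mul (f g : n → ℝ) :
    hA.spectralDiagonal f * hA.spectralDiagonal g = hA.spectralDiagonal (f * g) := by
  have hU : (hA.eigenvectorUnitary : Matrix n n ℂ)ᴴ * (hA.eigenvectorUnitary : Matrix n n ℂ) = 1 :=
    Unitary.coe_star_mul_self hA.eigenvectorUnitary
  simp only [spectralDiagonal, Pi.mul_apply, Complex.ofReal_mul, ← diagonal_mul_diagonal]
  simp only [mul_assoc]
  rw [← mul_assoc _ᴴ, hU, one_mul]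

theorem spectralDiagonal_sub (f g : n → ℝ) :
    hA.spectralDiagonal (f - g) = hA.spectralDiagonal f - hA.spectralDiagonal g := by
  simp only [spectralDiagonal, Pi.sub_apply, Complex.ofReal_sub, ← diagonal_sub, mul_sub, sub_mul]

theorem spectralDiagonal_zero : hA.spectralDiagonal 0 = 0 := by
  simp [spectralDiagonal]

theorem spectralDiagonal_eigenvalues : hA.spectralDiagonal hA.eigenvalues = A :=
  hA.spectral_theorem.symm

theorem posSemidef_spectralDiagonal {f : n → ℝ} (hf : 0 ≤ f) :
    (hA.spectralDiagonal f).PosSemidef := by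
  refine PosSemidef.mul_mul_conjTranspose_same (posSemidef_diagonal_iff.2 fun i => ?_) _
  exact_mod_cast hf i

theorem re_trace_spectralDiagonal (f : n → ℝ) : (hA.spectralDiagonal f).trace.re = ∑ i, f i := by
  have hU : (hA.eigenvectorUnitary : Matrix n n ℂ)ᴴ * (hA.eigenvectorUnitary : Matrix n n ℂ) = 1 :=
    Unitary.coe_star_mul_self hA.eigenvectorUnitary
  rw [spectralDiagonal, trace_mul_comm, ← mul_assoc, hU, one_mul, trace_diagonal]
  simp

end Matrix.IsHermitian

end

/-- Core of Theorem 4.9: if a Hermitian matrix `A` is compressed to zero by a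
`c`-quantum coloring, and `s⁺`, `s⁻` are the sums of squares of its positive
and negative eigenvalues, then `s⁺ ≤ (c-1)·s⁻` and `s⁻ ≤ (c-1)·s⁺`. -/
theorem sum_of_squares_bound (c N : ℕ) (hc : 1 ≤ c)
    (P : Fin c → Matrix (Fin N) (Fin N) ℂ)
    (hherm : ∀ k, (P k).IsHermitian)
    (hidem : ∀ k, P k * P k = P k)
    (horth : ∀ k l, k ≠ l → P k * P l = 0)
    (hsum : ∑ k, P k = 1)
    (A : Matrix (Fin N) (Fin N) ℂ) (hA : A.IsHermitian)
    (hcolor : ∀ k, P k * A * P k = 0) :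
    (∑ i ∈ Finset.univ.filter (fun i => 0 < hA.eigenvalues i),
        (hA.eigenvalues i) ^ 2) ≤
      (c - 1 : ℝ) * ∑ i ∈ Finset.univ.filter (fun i => hA.eigenvalues i < 0),
        (hA.eigenvalues i) ^ 2 ∧
    (∑ i ∈ Finset.univ.filter (fun i => hA.eigenvalues i < 0),
        (hA.eigenvalues i) ^ 2) ≤
      (c - 1 : ℝ) * ∑ i ∈ Finset.univ.filter (fun i => 0 < hA.eigenvalues i),
        (hA.eigenvalues i) ^ 2 := by
  set p := hA.eigenvalues⁺ with hp
  set q := hA.eigenvalues⁻ with hq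
  have hpq : p * q = 0 := by
    funext i
    rcases le_total 0 (hA.eigenvalues i) with h | h <;> simp [hp, hq, h]
  have hX := hA.posSemidef_spectralDiagonal (posPart_nonneg hA.eigenvalues)
  have hY := hA.posSemidef_spectralDiagonal (negPart_nonneg hA.eigenvalues)
  have hXY : hA.spectralDiagonal p * hA.spectralDiagonal q = 0 := by
    rw [hA.spectralDiagonal_mul, hpq, hA.spectralDiagonal_zero]
  have hYX : hA.spectralDiagonal q * hA.spectralDiagonal p = 0 := by
    rw [hA.spectralDiagonal_mul, mul_comm, hpq, hA.spectralDiagonal_zero]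
  have hdiag : ∀ k, P k * hA.spectralDiagonal p * P k = P k * hA.spectralDiagonal q * P k := by
    intro k
    rw [← sub_eq_zero, ← sub_mul, ← mul_sub, ← hA.spectralDiagonal_sub, hp, hq,
      posPart_sub_negPart, hA.spectralDiagonal_eigenvalues, hcolor]
  have hcard : 1 ≤ Fintype.card (Fin c) := by simpa using hc
  have hpos : ∑ i ∈ Finset.univ.filter (fun i => 0 < hA.eigenvalues i), hA.eigenvalues i ^ 2
      = (hA.spectralDiagonal p * hA.spectralDiagonal p).trace.re := by
    rw [hA.spectralDiagonal_mul, hA.re_trace_spectralDiagonal, Finset.sum_filter]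
    refine Finset.sum_congr rfl fun i _ => ?_
    split_ifs with h
    · simp [hp, h.le, sq]
    · simp [hp, not_lt.1 h]
  have hneg : ∑ i ∈ Finset.univ.filter (fun i => hA.eigenvalues i < 0), hA.eigenvalues i ^ 2
      = (hA.spectralDiagonal q * hA.spectralDiagonal q).trace.re := by
    rw [hA.spectralDiagonal_mul, hA.re_trace_spectralDiagonal, Finset.sum_filter]
    refine Finset.sum_congr rfl fun i _ => ?_
    split_ifs with h
    · simp [hq, h.le, sq]
    · simp [hq, not_lt.1 h]
  rw [hpos, hneg]
  have h₁ := hX.re_trace_mul_self_le_of_mul_eq_zero hY hXY hherm hidem horth hsum hdiag hcard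
  have h₂ := hY.re_trace_mul_self_le_of_mul_eq_zero hX hYX hherm hidem horth hsum
    (fun k => (hdiag k).symm) hcard
  rw [Fintype.card_fin] at h₁ h₂
  exact ⟨h₁, h₂⟩
end

section
/- Let c ≥ 1 and let P_1, …, P_c be N×N complex matrices that are Hermitian idempotents (orthogonal projections), pairwise orthogonal (P_i P_j = 0 for i ≠ j), and sum to the identity matrix. Let A be an N×N Hermitian complex matrix with P_k A P_k = 0 for all k = 1, …, c. Let n⁺ and n⁻ be the number of positive and negative eigenvalues of A respectively, counted with multiplicity. Then n⁺ ≤ (c−1)·n⁻ and n⁻ ≤ (c−1)·n⁺. -/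
open Matrix

/-- The quadratic form of a real diagonal matrix conjugated by `W`. -/
lemma star_dotProduct_conjTranspose_mul_diagonal_mul_mulVec {n : Type*} [Fintype n]
    [DecidableEq n] (d : n → ℝ) (W : Matrix n n ℂ) (x : n → ℂ) :
    star x ⬝ᵥ ((Wᴴ * diagonal (fun i => (d i : ℂ)) * W) *ᵥ x) =
      ((∑ i, d i * Complex.normSq ((W *ᵥ x) i) : ℝ) : ℂ) := by
  rw [← mulVec_mulVec, ← mulVec_mulVec, dotProduct_mulVec, ← star_mulVec]
  simp only [dotProduct, mulVec_diagonal, Pi.star_apply, Complex.ofReal_sum, Complex.ofReal_mul,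
    Complex.normSq_eq_conj_mul_self, starRingEnd_apply]
  exact Finset.sum_congr rfl fun i _ => by ring

/-- If a real diagonal matrix and `m` of its conjugates sum to zero, then its negative entries
are at most `m` times as many as its positive ones. -/
lemma card_neg_le_mul_card_pos {n : Type*} [Fintype n] [DecidableEq n] {m : ℕ} (d : n → ℝ)
    (W : Fin (m + 1) → Matrix n n ℂ) (hW : W 0 = 1)
    (h : ∑ l, (W l)ᴴ * diagonal (fun i => (d i : ℂ)) * W l = 0) :
    (Finset.univ.filter (fun i => d i < 0)).card ≤
      m * (Finset.univ.filter (fun i => 0 < d i)).card := by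
  by_contra! hlt
  let M : Matrix (Fin m × {i // 0 < d i}) {i // d i < 0} ℂ :=
    of fun p j => W p.1.succ p.2 j
  have hker : LinearMap.ker M.mulVecLin ≠ ⊥ := by
    apply LinearMap.ker_ne_bot_of_finrank_lt
    simpa [Fintype.card_subtype] using hlt
  obtain ⟨x, hx, hx0⟩ := (Submodule.ne_bot_iff _).1 hker
  let y : n → ℂ := fun i => if hi : d i < 0 then x ⟨i, hi⟩ else 0
  have hy : ∀ (l : Fin m) (i : n), 0 < d i → (W l.succ *ᵥ y) i = 0 := by
    intro l i hi
    have hM := congrFun (LinearMap.mem_ker.1 hx) (l, ⟨i, hi⟩)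
    have hin : ∑ j : {j // d j < 0}, W l.succ i j * y j = 0 := by
      refine Eq.trans (Finset.sum_congr rfl fun j _ => ?_) hM
      simp [M, y, j.2]
    have hout : ∑ j : {j // ¬ d j < 0}, W l.succ i j * y j = 0 :=
      Finset.sum_eq_zero fun j _ => by simp [y, j.2]
    rw [mulVec, dotProduct, ← Fintype.sum_subtype_add_sum_subtype (fun j => d j < 0), hin, hout,
      add_zero]
  have hsum : ∑ l, ∑ i, d i * Complex.normSq ((W l *ᵥ y) i) = 0 := by
    have hq := congrArg (fun B => star y ⬝ᵥ (B *ᵥ y)) h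
    simp only [sum_mulVec, dotProduct_sum,
      star_dotProduct_conjTranspose_mul_diagonal_mul_mulVec, zero_mulVec, dotProduct_zero] at hq
    exact_mod_cast hq
  rw [Fin.sum_univ_succ, hW, one_mulVec] at hsum
  have htail : ∑ l : Fin m, ∑ i, d i * Complex.normSq ((W l.succ *ᵥ y) i) ≤ 0 := by
    refine Finset.sum_nonpos fun l _ => Finset.sum_nonpos fun i _ => ?_
    rcases lt_or_ge 0 (d i) with hi | hi
    · simp [hy l i hi]
    · exact mul_nonpos_of_nonpos_of_nonneg hi (Complex.normSq_nonneg _)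
  have hhead : ∑ i, d i * Complex.normSq (y i) < 0 := by
    obtain ⟨j, hj⟩ := Function.ne_iff.1 hx0
    refine Finset.sum_neg' (fun i _ => ?_) ⟨j, Finset.mem_univ _, ?_⟩
    · by_cases hi : d i < 0
      · exact mul_nonpos_of_nonpos_of_nonneg hi.le (Complex.normSq_nonneg _)
      · simp [y, hi]
    · have hyj : y j = x j := by simp [y, j.2]
      rw [hyj]
      exact mul_neg_of_neg_of_pos j.2 (Complex.normSq_pos.2 hj)
  linarith

/-- If all diagonal blocks `P k * A * P k` vanish, then the conjugates of `A` by the twists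
`∑ k, ζ ^ (k * l) • P k`, with `ζ` a primitive `c`-th root of unity, sum to zero. -/
lemma sum_conjTranspose_twist_mul_mul_twist {n : Type*} [Fintype n] [DecidableEq n] {c : ℕ}
    (P : Fin c → Matrix n n ℂ) (hherm : ∀ k, (P k).IsHermitian) (A : Matrix n n ℂ)
    (hcolor : ∀ k, P k * A * P k = 0) {ζ : ℂ} (hζ : IsPrimitiveRoot ζ c) :
    ∑ l : Fin c, (∑ k : Fin c, ζ ^ ((k : ℕ) * l) • P k)ᴴ * A *
      (∑ k : Fin c, ζ ^ ((k : ℕ) * l) • P k) = 0 := by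
  simp only [conjTranspose_sum, conjTranspose_smul, (hherm _).eq, Finset.sum_mul, Finset.mul_sum,
    smul_mul_assoc, mul_smul_comm, Finset.smul_sum, smul_smul]
  rw [Finset.sum_comm]
  refine Finset.sum_eq_zero fun k _ => ?_
  rw [Finset.sum_comm]
  refine Finset.sum_eq_zero fun j _ => ?_
  rw [← Finset.sum_smul]
  rcases eq_or_ne j k with rfl | hjk
  · rw [hcolor, smul_zero]
  have hc : c ≠ 0 := (Fin.pos j).ne'
  have hz : star ζ = ζ⁻¹ := (Complex.inv_eq_conj (hζ.norm'_eq_one hc)).symm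
  have hζ0 : ζ ≠ 0 := hζ.ne_zero hc
  set r : ℂ := (ζ⁻¹) ^ (j : ℕ) * ζ ^ (k : ℕ) with hr
  have hr1 : r ≠ 1 := by
    intro h1
    apply hjk
    rw [hr, inv_pow, inv_mul_eq_one₀ (pow_ne_zero _ hζ0)] at h1
    exact Fin.ext (hζ.pow_inj j.2 k.2 h1)
  have hrc : r ^ c = 1 := by
    rw [hr, mul_pow, ← pow_mul, ← pow_mul, mul_comm, mul_comm (j : ℕ), mul_comm (k : ℕ), pow_mul,
      pow_mul, inv_pow, hζ.pow_eq_one]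
    simp
  have hgeom : ∑ l : Fin c, r ^ (l : ℕ) = 0 := by
    rw [Fin.sum_univ_eq_sum_range (fun l => r ^ l), geom_sum_eq hr1, hrc, sub_self, zero_div]
  convert zero_smul ℂ (P j * A * P k)
  rw [← hgeom]
  refine Finset.sum_congr rfl fun l _ => ?_
  rw [star_pow, hz, hr, mul_pow, ← pow_mul, ← pow_mul, mul_comm]

/-- Core of Theorem 4.11 (inertial bound): if a Hermitian matrix `A` is
compressed to zero by a `c`-quantum coloring, and `n⁺`, `n⁻` are the numbers of
positive and negative eigenvalues of `A` (with multiplicity), then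
`n⁺ ≤ (c-1)·n⁻` and `n⁻ ≤ (c-1)·n⁺`. -/
theorem inertia_bound (c N : ℕ) (hc : 1 ≤ c)
    (P : Fin c → Matrix (Fin N) (Fin N) ℂ)
    (hherm : ∀ k, (P k).IsHermitian)
    (hidem : ∀ k, P k * P k = P k)
    (horth : ∀ k l, k ≠ l → P k * P l = 0)
    (hsum : ∑ k, P k = 1)
    (A : Matrix (Fin N) (Fin N) ℂ) (hA : A.IsHermitian)
    (hcolor : ∀ k, P k * A * P k = 0) :
    (Finset.univ.filter (fun i => 0 < hA.eigenvalues i)).card ≤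
      (c - 1) * (Finset.univ.filter (fun i => hA.eigenvalues i < 0)).card ∧
    (Finset.univ.filter (fun i => hA.eigenvalues i < 0)).card ≤
      (c - 1) * (Finset.univ.filter (fun i => 0 < hA.eigenvalues i)).card := by
  obtain ⟨m, rfl⟩ : ∃ m, c = m + 1 := ⟨c - 1, by omega⟩
  let ζ : ℂ := Complex.exp (2 * Real.pi * Complex.I / (m + 1 : ℕ))
  have hζ : IsPrimitiveRoot ζ (m + 1) := Complex.isPrimitiveRoot_exp _ (Nat.succ_ne_zero m)
  let T : Fin (m + 1) → Matrix (Fin N) (Fin N) ℂ := fun l =>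
    ∑ k : Fin (m + 1), ζ ^ ((k : ℕ) * l) • P k
  let U : Matrix (Fin N) (Fin N) ℂ := hA.eigenvectorUnitary
  let D : Matrix (Fin N) (Fin N) ℂ := diagonal fun i => (hA.eigenvalues i : ℂ)
  let W : Fin (m + 1) → Matrix (Fin N) (Fin N) ℂ := fun l => Uᴴ * T l * U
  have hU : Uᴴ * U = 1 := Unitary.coe_star_mul_self hA.eigenvectorUnitary
  have hAD : A = U * D * Uᴴ := by
    conv_lhs => rw [hA.spectral_theorem, Unitary.conjStarAlgAut_apply]
    rfl
  have hW : W 0 = 1 := by simp [W, T, hsum, hU]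
  have hWD : ∑ l, (W l)ᴴ * D * W l = 0 := by
    have hterm : ∀ l, (W l)ᴴ * D * W l = Uᴴ * ((T l)ᴴ * A * T l) * U := fun l => by
      rw [hAD]
      simp only [W, conjTranspose_mul, conjTranspose_conjTranspose, Matrix.mul_assoc]
    rw [Finset.sum_congr rfl fun l _ => hterm l, ← Finset.sum_mul, ← Finset.mul_sum,
      show ∑ l, (T l)ᴴ * A * T l = 0 from sum_conjTranspose_twist_mul_mul_twist P hherm A hcolor hζ,
      mul_zero, zero_mul]
  refine ⟨?_, card_neg_le_mul_card_pos _ W hW hWD⟩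
  have hneg : (diagonal fun i => ((-hA.eigenvalues i : ℝ) : ℂ)) = -D := by
    simp [D, diagonal_neg]
  simpa using card_neg_le_mul_card_pos (fun i => -hA.eigenvalues i) W hW
    (by simp only [hneg, mul_neg, neg_mul, Finset.sum_neg_distrib, hWD, neg_zero])
end

section
/- Let c ≥ 1 and let P_1, …, P_c be N×N complex matrices that are Hermitian idempotents (orthogonal projections), pairwise orthogonal (P_i P_j = 0 for i ≠ j), and sum to the identity matrix, with N ≥ 1. Let A be an N×N Hermitian complex matrix with P_k A P_k = 0 for all k = 1, …, c, and let D be an N×N Hermitian complex matrix commuting with every P_k. Then for every unit vector ξ ∈ ℂ^N, ⟨ξ, A ξ⟩ ≤ (c−1)·⟨ξ, D ξ⟩ − (c−1)·λ_min(D + A), where λ_min(D + A) is the smallest eigenvalue of the Hermitian matrix D + A. -/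
open Matrix
open scoped ComplexOrder

open scoped MatrixOrder in
/-- A Hermitian matrix dominates its smallest eigenvalue. -/
theorem Matrix.IsHermitian.posSemidef_sub_iInf_eigenvalues {n : Type*} [Fintype n] [DecidableEq n]
    {H : Matrix n n ℂ} (hH : H.IsHermitian) :
    (H - algebraMap ℝ (Matrix n n ℂ) (⨅ i, hH.eigenvalues i)).PosSemidef := by
  refine Matrix.le_iff.mp (algebraMap_le_of_le_spectrum (fun {x} hx => ?_) hH.isSelfAdjoint)
  rw [hH.spectrum_real_eq_range_eigenvalues] at hx
  obtain ⟨i, rfl⟩ := hx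
  exact ciInf_le (Set.finite_range _).bddBelow i

/-- The difference form of the pinching inequality `M ≤ c • ∑ k, P k * M * P k`. -/
theorem sum_sub_mul_mul_sub {R ι : Type*} [Ring R] [Fintype ι] (P : ι → R) (hsum : ∑ k, P k = 1)
    (M : R) :
    ∑ k, ∑ l, (P k - P l) * M * (P k - P l) =
      2 • (Fintype.card ι • ∑ k, P k * M * P k - M) := by
  have hcross : ∑ k, ∑ l, P k * M * P l = M := by
    simp_rw [← Finset.mul_sum, hsum, mul_one, ← Finset.sum_mul, hsum, one_mul]
  have hcross_swap : ∑ k, ∑ l, P l * M * P k = M := by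
    rw [Finset.sum_comm, hcross]
  simp only [sub_mul, mul_sub, Finset.sum_sub_distrib, hcross, hcross_swap, Finset.sum_const,
    Finset.card_univ, ← Finset.smul_sum]
  abel

/-- The pinching inequality for a resolution of the identity into Hermitian matrices. -/
theorem Matrix.PosSemidef.card_smul_pinching_sub {n ι : Type*} [Fintype n] [DecidableEq n]
    [Fintype ι] {M : Matrix n n ℂ} (hM : M.PosSemidef) (P : ι → Matrix n n ℂ)
    (hherm : ∀ k, (P k).IsHermitian) (hsum : ∑ k, P k = 1) :
    (Fintype.card ι • ∑ k, P k * M * P k - M).PosSemidef := by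
  have h : (∑ k, ∑ l, (P k - P l) * M * (P k - P l)).PosSemidef := by
    refine Matrix.posSemidef_sum _ fun k _ => Matrix.posSemidef_sum _ fun l _ => ?_
    have hkl := hM.mul_mul_conjTranspose_same (P k - P l)
    rwa [((hherm k).sub (hherm l)).eq] at hkl
  rw [sum_sub_mul_mul_sub P hsum] at h
  have hhalf := h.smul (show (0 : ℝ) ≤ 2⁻¹ by norm_num)
  rwa [← Nat.cast_smul_eq_nsmul ℝ 2, smul_smul, Nat.cast_ofNat, inv_mul_cancel₀ two_ne_zero,
    one_smul] at hhalf

/-- Core inequality of Theorem 4.5: if `A` is compressed to zero by a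
`c`-quantum coloring and `D` commutes with each projection, then for every unit
vector `ξ`, `⟨ξ, Aξ⟩ ≤ (c-1)·⟨ξ, Dξ⟩ − (c-1)·λ_min(D+A)`. -/
theorem edge_bound_inequality (c N : ℕ) (hc : 1 ≤ c) (hN : 1 ≤ N)
    (P : Fin c → Matrix (Fin N) (Fin N) ℂ)
    (hherm : ∀ k, (P k).IsHermitian)
    (hidem : ∀ k, P k * P k = P k)
    (horth : ∀ k l, k ≠ l → P k * P l = 0)
    (hsum : ∑ k, P k = 1)
    (A : Matrix (Fin N) (Fin N) ℂ) (hA : A.IsHermitian)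
    (hcolor : ∀ k, P k * A * P k = 0)
    (D : Matrix (Fin N) (Fin N) ℂ) (hD : D.IsHermitian)
    (hDcomm : ∀ k, D * P k = P k * D)
    (ξ : Fin N → ℂ) (hξ : star ξ ⬝ᵥ ξ = 1) :
    star ξ ⬝ᵥ A.mulVec ξ ≤
      ((c : ℂ) - 1) * (star ξ ⬝ᵥ D.mulVec ξ) -
        ((c : ℂ) - 1) * ((⨅ i, (hD.add hA).eigenvalues i : ℝ) : ℂ) := by
  set r : ℝ := ⨅ i, (hD.add hA).eigenvalues i
  have hpsd := (hD.add hA).posSemidef_sub_iInf_eigenvalues.card_smul_pinching_sub P hherm hsum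
  have hpinch : ∑ k, P k * (D + A - algebraMap ℝ (Matrix (Fin N) (Fin N) ℂ) r) * P k =
      D - algebraMap ℝ (Matrix (Fin N) (Fin N) ℂ) r := by
    have hterm (k) : P k * (D + A - algebraMap ℝ (Matrix (Fin N) (Fin N) ℂ) r) * P k =
        (D - algebraMap ℝ (Matrix (Fin N) (Fin N) ℂ) r) * P k := by
      rw [mul_sub, mul_add, sub_mul, add_mul, hcolor, ← hDcomm, ← Algebra.commutes, mul_assoc,
        mul_assoc, hidem, add_zero, sub_mul]
    simp_rw [hterm, ← Finset.mul_sum, hsum, mul_one]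
  rw [hpinch, Fintype.card_fin] at hpsd
  have hnonneg := hpsd.dotProduct_mulVec_nonneg ξ
  have hr : algebraMap ℝ (Matrix (Fin N) (Fin N) ℂ) r = (r : ℂ) • 1 := by
    rw [Algebra.algebraMap_eq_smul_one, Complex.coe_smul]
  rw [hr, ← Nat.cast_smul_eq_nsmul ℂ c] at hnonneg
  simp only [sub_mulVec, add_mulVec, smul_mulVec, one_mulVec, dotProduct_sub, dotProduct_add,
    dotProduct_smul, hξ, smul_eq_mul, mul_one] at hnonneg
  rw [← sub_nonneg]
  convert hnonneg using 1
  ring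
end
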